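/- For all integers a > b ≥ 1 with n = a + b, there exists a proper colouring of the Mycielskian μ(K_{a,b}) of the complete bipartite graph K_{a,b} using the three colours 1, 2, 3 whose colouring mean equals (2a+4b+3)/(2n+1) = 1 + 2(b+1)/(2n+1) and whose colouring variance equals (16a²+4b²+8a²b+8ab²+24ab+8a+2b)/(2n+1)³. -/

import Mathlib

open Finset

/-- The Mycielskian of a graph `G` on vertex set `V`: vertices are
`V ⊕ V ⊕ Unit` where `Sum.inl a` is the original vertex `v_a`,
`Sum.inr (Sum.inl a)` is the shadow vertex `u_a`, and `Sum.inr (Sum.inr ())`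
is the apex vertex `u`. -/
def mycielskian {V : Type*} (G : SimpleGraph V) : SimpleGraph (V ⊕ V ⊕ Unit) :=
  SimpleGraph.fromRel (fun x y =>
    match x, y with
    | Sum.inl a, Sum.inl b => G.Adj a b
    | Sum.inl a, Sum.inr (Sum.inl b) => G.Adj a b
    | Sum.inr (Sum.inl _), Sum.inr (Sum.inr _) => True
    | _, _ => False)

/-- `colClass c i` is the number of vertices receiving colour `i`. -/
def colClass {V : Type*} [Fintype V] (c : V → ℕ) (i : ℕ) : ℕ :=
  (Finset.univ.filter (fun v => c v = i)).card

/-- The colouring mean of a colouring `c` using colours `1, …, k`. -/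
def colMean {V : Type*} [Fintype V] (c : V → ℕ) (k : ℕ) : ℚ :=
  (∑ i ∈ Finset.Icc 1 k, (i : ℚ) * (colClass c i)) / (Fintype.card V : ℚ)

/-- The colouring variance of a colouring `c` using colours `1, …, k`. -/
def colVar {V : Type*} [Fintype V] (c : V → ℕ) (k : ℕ) : ℚ :=
  (∑ i ∈ Finset.Icc 1 k, (i : ℚ) ^ 2 * (colClass c i)) / (Fintype.card V : ℚ)
    - (colMean c k) ^ 2

/-- The path graph `P_n` on `Fin n`. -/
def pathG (n : ℕ) : SimpleGraph (Fin n) :=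
  SimpleGraph.fromRel (fun i j => (i : ℕ) + 1 = (j : ℕ))

/-- The complete bipartite graph $K_{a,b}$ on `Fin a ⊕ Fin b`. -/
def completeBipartiteG (a b : ℕ) : SimpleGraph (Fin a ⊕ Fin b) :=
  SimpleGraph.fromRel (fun x y => x.isLeft = true ∧ y.isLeft = false)

/-- The colouring of the Mycielskian of `K_{a,b}` giving colour `1` to the first part and its
shadows, colour `2` to the second part and its shadows, and colour `3` to the apex. -/
def bipartiteMycielskianColouring (a b : ℕ) :
    (Fin a ⊕ Fin b) ⊕ (Fin a ⊕ Fin b) ⊕ Unit → ℕ :=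
  Sum.elim (Sum.elim (fun _ => 1) (fun _ => 2))
    (Sum.elim (Sum.elim (fun _ => 1) (fun _ => 2)) (fun _ => 3))

theorem bipartiteMycielskianColouring_mem_Icc (a b : ℕ)
    (v : (Fin a ⊕ Fin b) ⊕ (Fin a ⊕ Fin b) ⊕ Unit) :
    bipartiteMycielskianColouring a b v ∈ Finset.Icc 1 3 := by
  rcases v with (_ | _) | (_ | _) | _ <;> simp [bipartiteMycielskianColouring]

theorem bipartiteMycielskianColouring_ne_of_adj {a b : ℕ}
    {x y : (Fin a ⊕ Fin b) ⊕ (Fin a ⊕ Fin b) ⊕ Unit}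
    (h : (mycielskian (completeBipartiteG a b)).Adj x y) :
    bipartiteMycielskianColouring a b x ≠ bipartiteMycielskianColouring a b y := by
  rcases x with (_ | _) | (_ | _) | _ <;> rcases y with (_ | _) | (_ | _) | _ <;>
    simp_all [bipartiteMycielskianColouring, mycielskian, completeBipartiteG]

/-- Summing over colour classes is the same as summing over vertices. -/
theorem sum_mul_colClass {V : Type*} [Fintype V] (c : V → ℕ) (s : Finset ℕ)
    (hc : ∀ v, c v ∈ s) (f : ℕ → ℚ) :
    ∑ i ∈ s, f i * (colClass c i : ℚ) = ∑ v, f (c v) := by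
  rw [← Finset.sum_fiberwise_of_maps_to (fun v _ => hc v)]
  refine Finset.sum_congr rfl fun i _ => ?_
  rw [Finset.sum_congr rfl fun v hv => by rw [(Finset.mem_filter.mp hv).2],
    Finset.sum_const, nsmul_eq_mul, mul_comm, colClass]

theorem colMean_bipartiteMycielskianColouring (a b : ℕ) :
    colMean (bipartiteMycielskianColouring a b) 3 =
      (2 * (a : ℚ) + 4 * b + 3) / (2 * ((a : ℚ) + b) + 1) := by
  rw [colMean, sum_mul_colClass _ _ (bipartiteMycielskianColouring_mem_Icc a b) (fun i => (i : ℚ))]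
  simp only [bipartiteMycielskianColouring, Fintype.sum_sum_type, Sum.elim_inl, Sum.elim_inr,
    Finset.sum_const, Finset.card_univ, Fintype.card_sum, Fintype.card_fin, Fintype.card_unit,
    nsmul_eq_mul]
  push_cast
  congr 1 <;> ring

theorem colVar_bipartiteMycielskianColouring (a b : ℕ) :
    colVar (bipartiteMycielskianColouring a b) 3 =
      (2 * (a : ℚ) + 8 * b + 9) / (2 * ((a : ℚ) + b) + 1) -
        ((2 * (a : ℚ) + 4 * b + 3) / (2 * ((a : ℚ) + b) + 1)) ^ 2 := by
  rw [colVar, colMean_bipartiteMycielskianColouring,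
    sum_mul_colClass _ _ (bipartiteMycielskianColouring_mem_Icc a b) (fun i => (i : ℚ) ^ 2)]
  simp only [bipartiteMycielskianColouring, Fintype.sum_sum_type, Sum.elim_inl, Sum.elim_inr,
    Finset.sum_const, Finset.card_univ, Fintype.card_sum, Fintype.card_fin, Fintype.card_unit,
    nsmul_eq_mul]
  push_cast
  congr 2 <;> ring

/-- The $χ$-chromatic mean and variance of the Mycielskian of $K_{a,b}$. -/
theorem chi_chromatic_parameters_mycielskian_completeBipartite
    (a b n : ℕ) (hb : 1 ≤ b) (hab : b < a) (hn : n = a + b) :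
    ∃ c : ((Fin a ⊕ Fin b) ⊕ (Fin a ⊕ Fin b) ⊕ Unit) → ℕ,
      (∀ v, c v ∈ Finset.Icc 1 3) ∧
      (∀ x y, (mycielskian (completeBipartiteG a b)).Adj x y → c x ≠ c y) ∧
      colMean c 3 = (2 * (a : ℚ) + 4 * (b : ℚ) + 3) / (2 * (n : ℚ) + 1) ∧
      colMean c 3 = 1 + 2 * ((b : ℚ) + 1) / (2 * (n : ℚ) + 1) ∧
      colVar c 3 = (16 * (a : ℚ) ^ 2 + 4 * (b : ℚ) ^ 2 + 8 * (a : ℚ) ^ 2 * (b : ℚ)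
          + 8 * (a : ℚ) * (b : ℚ) ^ 2 + 24 * (a : ℚ) * (b : ℚ) + 8 * (a : ℚ) + 2 * (b : ℚ))
        / (2 * (n : ℚ) + 1) ^ 3 := by
  subst hn
  have hN : 2 * ((a : ℚ) + b) + 1 ≠ 0 := by positivity
  refine ⟨bipartiteMycielskianColouring a b, bipartiteMycielskianColouring_mem_Icc a b,
    fun _ _ => bipartiteMycielskianColouring_ne_of_adj, ?_, ?_, ?_⟩
  · rw [colMean_bipartiteMycielskianColouring, Nat.cast_add]
  · rw [colMean_bipartiteMycielskianColouring, Nat.cast_add]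
    field_simp
    ring
  · rw [colVar_bipartiteMycielskianColouring, Nat.cast_add]
    field_simp
    ring
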